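/- arXiv:1107.5835 — 4 statements merged into one kernel-verified Lean document; each statement's English description precedes it below -/
import Mathlib

section
/- Let β : ℝ → ℝ be differentiable, let ℰ ∈ ℝ and v ∈ ℝ³, and let b : ℝ³ → ℝ be a twice continuously differentiable function satisfying the ground state equation −Δb(x) − β'(b(x)²)·b(x) + ℰ·b(x) = 0 for all x ∈ ℝ³. Then the traveling soliton ψ(x,t) := e^{i((ℰ − |v|²/4)·t + v·x/2)} · b(x − v t) satisfies the nonlinear Schrödinger equation ∂_t ψ(x,t) = i·Δψ(x,t) + i·β'(|ψ(x,t)|²)·ψ(x,t) for all x ∈ ℝ³ and t ∈ ℝ. -/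
open MeasureTheory

/-- Euclidean dot product on `ℝ³ = Fin 3 → ℝ`. -/
def dot3 (v x : Fin 3 → ℝ) : ℝ := ∑ j, v j * x j

/-- The `j`-th partial derivative of a complex-valued function on `ℝ³`. -/
noncomputable def pdC (j : Fin 3) (f : (Fin 3 → ℝ) → ℂ) : (Fin 3 → ℝ) → ℂ :=
  fun x => fderiv ℝ f x (Pi.single j 1)

/-- The Laplacian (sum of second partial derivatives) of a complex-valued function on `ℝ³`. -/
noncomputable def lapC (f : (Fin 3 → ℝ) → ℂ) : (Fin 3 → ℝ) → ℂ :=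
  fun x => ∑ j : Fin 3, pdC j (pdC j f) x

/-- The `j`-th partial derivative of a real-valued function on `ℝ³`. -/
noncomputable def pdR (j : Fin 3) (f : (Fin 3 → ℝ) → ℝ) : (Fin 3 → ℝ) → ℝ :=
  fun x => fderiv ℝ f x (Pi.single j 1)

/-- The Laplacian of a real-valued function on `ℝ³`. -/
noncomputable def lapR (f : (Fin 3 → ℝ) → ℝ) : (Fin 3 → ℝ) → ℝ :=
  fun x => ∑ j : Fin 3, pdR j (pdR j f) x

theorem hasFDerivAt_dot3 (v x : Fin 3 → ℝ) :
    HasFDerivAt (dot3 v) (∑ j, v j • ContinuousLinearMap.proj (R := ℝ) (φ := fun _ => ℝ) j) x := by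
  unfold dot3
  refine HasFDerivAt.fun_sum fun j _ => ?_
  exact (hasFDerivAt_apply j x).const_mul (v j)

theorem pdC_plane_wave_mul (v : Fin 3 → ℝ) (c : ℝ) {g : (Fin 3 → ℝ) → ℂ}
    (hg : Differentiable ℝ g) (j : Fin 3) :
    pdC j (fun y => Complex.exp (Complex.I * ((c + dot3 v y / 2 : ℝ) : ℂ)) * g y) =
      fun y => Complex.exp (Complex.I * ((c + dot3 v y / 2 : ℝ) : ℂ)) *
        (Complex.I * (v j / 2) * g y + pdC j g y) := by
  funext x
  have hphase : HasFDerivAt (fun y => c + dot3 v y / 2) _ x :=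
    ((hasFDerivAt_dot3 v x).mul_const (2⁻¹ : ℝ)).const_add c
  have hexp := ((Complex.ofRealCLM.hasFDerivAt.comp x hphase).const_mul Complex.I).cexp
  have h := hexp.mul (hg x).hasFDerivAt
  unfold pdC
  refine (congrArg (fun L => L (Pi.single j 1)) h.fderiv).trans ?_
  simp [Pi.single_apply]
  ring

theorem pdC_add {f g : (Fin 3 → ℝ) → ℂ} (hf : Differentiable ℝ f) (hg : Differentiable ℝ g)
    (j : Fin 3) (x : Fin 3 → ℝ) :
    pdC j (fun y => f y + g y) x = pdC j f x + pdC j g x := by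
  simp [pdC, fderiv_fun_add (hf x) (hg x)]

theorem pdC_const_mul (a : ℂ) {f : (Fin 3 → ℝ) → ℂ} (hf : Differentiable ℝ f)
    (j : Fin 3) (x : Fin 3 → ℝ) :
    pdC j (fun y => a * f y) x = a * pdC j f x := by
  simp [pdC, fderiv_const_mul (hf x) a]

theorem pdC_ofReal_comp_sub {f : (Fin 3 → ℝ) → ℝ} (hf : Differentiable ℝ f)
    (a : Fin 3 → ℝ) (j : Fin 3) :
    pdC j (fun y => ((f (y - a) : ℝ) : ℂ)) = fun y => ((pdR j f (y - a) : ℝ) : ℂ) := by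
  funext x
  have hshift := (hf (x - a)).hasFDerivAt.comp x ((hasFDerivAt_id x).sub_const a)
  have h := Complex.ofRealCLM.hasFDerivAt.comp x hshift
  unfold pdC pdR
  refine (congrArg (fun L => L (Pi.single j 1)) h.fderiv).trans ?_
  simp

theorem ContDiff.differentiable_pdR {f : (Fin 3 → ℝ) → ℝ} (hf : ContDiff ℝ 2 f) (j : Fin 3) :
    Differentiable ℝ (pdR j f) := by
  have h : ContDiff ℝ 1 (fderiv ℝ f) := hf.fderiv_right (by norm_num)
  exact (h.clm_apply contDiff_const).differentiable one_ne_zero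

theorem fderiv_apply_eq_sum_pdR (f : (Fin 3 → ℝ) → ℝ) (x w : Fin 3 → ℝ) :
    fderiv ℝ f x w = ∑ j, w j * pdR j f x := by
  conv_lhs => rw [pi_eq_sum_univ' w, map_sum]
  refine Finset.sum_congr rfl fun j _ => ?_
  simp [pdR]

theorem lapC_plane_wave_mul_ofReal_comp_sub (v a : Fin 3 → ℝ) (c : ℝ)
    {f : (Fin 3 → ℝ) → ℝ} (hf : ContDiff ℝ 2 f) (x : Fin 3 → ℝ) :
    lapC (fun y => Complex.exp (Complex.I * ((c + dot3 v y / 2 : ℝ) : ℂ)) *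
        ((f (y - a) : ℝ) : ℂ)) x =
      Complex.exp (Complex.I * ((c + dot3 v x / 2 : ℝ) : ℂ)) *
        (-((dot3 v v / 4 * f (x - a) : ℝ) : ℂ)
          + Complex.I * ((fderiv ℝ f (x - a) v : ℝ) : ℂ) + ((lapR f (x - a) : ℝ) : ℂ)) := by
  have hd : Differentiable ℝ f := hf.differentiable two_ne_zero
  have hcomp : ∀ {g : (Fin 3 → ℝ) → ℝ}, Differentiable ℝ g →
      Differentiable ℝ (fun y => ((g (y - a) : ℝ) : ℂ)) := fun hg =>
    Complex.ofRealCLM.differentiable.comp (hg.comp (differentiable_id.sub_const a))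
  have hpd (j : Fin 3) := hf.differentiable_pdR j
  have hterm (j : Fin 3) := (hcomp hd).const_mul (Complex.I * ((v j : ℂ) / 2))
  have hsecond (j : Fin 3) :
      pdC j (pdC j (fun y => Complex.exp (Complex.I * ((c + dot3 v y / 2 : ℝ) : ℂ)) *
        ((f (y - a) : ℝ) : ℂ))) x =
      Complex.exp (Complex.I * ((c + dot3 v x / 2 : ℝ) : ℂ)) *
        (-((v j * v j / 4 * f (x - a) : ℝ) : ℂ)
          + Complex.I * ((v j * pdR j f (x - a) : ℝ) : ℂ)
          + ((pdR j (pdR j f) (x - a) : ℝ) : ℂ)) := by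
    rw [pdC_plane_wave_mul v c (hcomp hd), pdC_ofReal_comp_sub hd]
    beta_reduce
    rw [pdC_plane_wave_mul v c ((hterm j).fun_add (hcomp (hpd j)))]
    beta_reduce
    rw [pdC_add (hterm j) (hcomp (hpd j)), pdC_const_mul _ (hcomp hd),
      pdC_ofReal_comp_sub hd, pdC_ofReal_comp_sub (hpd j)]
    push_cast
    linear_combination (Complex.exp (Complex.I * (c + dot3 v x / 2)) *
      (v j * v j / 4 * f (x - a))) * Complex.I_sq
  unfold lapC
  rw [Finset.sum_congr rfl fun j _ => hsecond j, ← Finset.mul_sum]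
  congr 1
  simp only [fderiv_apply_eq_sum_pdR, lapR, dot3, Fin.sum_univ_three]
  push_cast
  ring

theorem hasDerivAt_traveling_wave (v x : Fin 3 → ℝ) (ω c : ℝ)
    {f : (Fin 3 → ℝ) → ℝ} (hf : Differentiable ℝ f) (t : ℝ) :
    HasDerivAt (fun s : ℝ => Complex.exp (Complex.I * ((ω * s + c : ℝ) : ℂ)) *
        ((f (x - s • v) : ℝ) : ℂ))
      (Complex.exp (Complex.I * ((ω * t + c : ℝ) : ℂ)) *
        (Complex.I * ((ω * f (x - t • v) : ℝ) : ℂ)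
          - ((fderiv ℝ f (x - t • v) v : ℝ) : ℂ))) t := by
  have hphase : HasDerivAt (fun s : ℝ => ω * s + c) _ t :=
    ((hasDerivAt_id t).const_mul ω).add_const c
  have hexp := (hphase.ofReal_comp.const_mul Complex.I).cexp
  have hshift : HasDerivAt (fun s : ℝ => x - s • v) _ t :=
    ((hasDerivAt_id t).smul_const v).const_sub x
  have hprofile := ((hf (x - t • v)).hasFDerivAt.comp_hasDerivAt t hshift).ofReal_comp
  refine (hexp.mul hprofile).congr_deriv ?_
  simp
  ring

/-- if `b` is a `C²` ground state profile, i.e.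
`−Δb − β'(b²)·b + ℰ·b = 0`, then the traveling soliton
`ψ(x,t) = e^{i((ℰ − |v|²/4)t + v·x/2)} b(x − vt)` solves the NLS
`∂ₜψ = iΔψ + iβ'(|ψ|²)ψ`. -/
theorem traveling_soliton_solves_NLS
    (β : ℝ → ℝ) (hβ : Differentiable ℝ β) (ℰ : ℝ) (v : Fin 3 → ℝ)
    (b : (Fin 3 → ℝ) → ℝ) (hb : ContDiff ℝ 2 b)
    (hground : ∀ x, -(lapR b x) - deriv β (b x ^ 2) * b x + ℰ * b x = 0)
    (ψ : ℝ → (Fin 3 → ℝ) → ℂ)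
    (hψ : ψ = fun t x =>
      Complex.exp (Complex.I * (((ℰ - dot3 v v / 4) * t + dot3 v x / 2 : ℝ) : ℂ)) *
        ((b (x - t • v) : ℝ) : ℂ)) :
    ∀ (x : Fin 3 → ℝ) (t : ℝ),
      HasDerivAt (fun s => ψ s x)
        (Complex.I * lapC (fun y => ψ t y) x
          + Complex.I * ((deriv β (‖ψ t x‖ ^ 2) : ℝ) : ℂ) * ψ t x) t := by
  intro x t
  subst hψ
  have hnorm : ‖Complex.exp (Complex.I * (((ℰ - dot3 v v / 4) * t + dot3 v x / 2 : ℝ) : ℂ)) *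
      ((b (x - t • v) : ℝ) : ℂ)‖ ^ 2 = b (x - t • v) ^ 2 := by
    rw [norm_mul, mul_comm Complex.I, Complex.norm_exp_ofReal_mul_I, one_mul,
      Complex.norm_real, Real.norm_eq_abs, sq_abs]
  refine (hasDerivAt_traveling_wave v x (ℰ - dot3 v v / 4) (dot3 v x / 2)
    (hb.differentiable two_ne_zero) t).congr_deriv ?_
  beta_reduce
  rw [hnorm, lapC_plane_wave_mul_ofReal_comp_sub v (t • v) _ hb x]
  have hg := congrArg (fun r : ℝ => (r : ℂ)) (hground (x - t • v))
  push_cast at hg ⊢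
  linear_combination (Complex.I *
      Complex.exp (Complex.I * ((ℰ - dot3 v v / 4) * t + dot3 v x / 2))) * hg -
    (Complex.exp (Complex.I * ((ℰ - dot3 v v / 4) * t + dot3 v x / 2)) *
      fderiv ℝ b (x - t • v) v) * Complex.I_sq
end

section
/- Every U ∈ H admits a unique decomposition U = Σ_{j=1}^{n} P_j τ_j + Σ_{j=1}^{n} Q^j (J A_j η) + Φ with real coefficients P_j, Q^j and a vector Φ ∈ H satisfying ⟨A_j η, Φ⟩ = 0 and ⟨E τ_j, Φ⟩ = 0 for all j = 1, …, n. Moreover the coefficients are given explicitly by Q^j = −⟨E τ_j, U⟩ and P_j = ⟨A_j η, U⟩, and Φ = Π U, where Π U := U − Σ_j ⟨A_j η, U⟩ τ_j + Σ_j ⟨E τ_j, U⟩ (J A_j η); the map Π is a continuous linear projection, i.e. Π ∘ Π = Π. -/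
open scoped RealInnerProductSpace

/-- The projection `Π` onto the symplectic orthogonal of the soliton manifold:
`Π U = U − Σⱼ ⟨Aⱼη, U⟩ τⱼ + Σⱼ ⟨Eτⱼ, U⟩ (J Aⱼ η)`. -/
noncomputable def PiProj {H : Type*} [NormedAddCommGroup H] [InnerProductSpace ℝ H]
    {n : ℕ} (E J : H →L[ℝ] H) (A : Fin n → H →L[ℝ] H) (η : H) (τ : Fin n → H)
    (U : H) : H :=
  U - (∑ j, ⟪A j η, U⟫ • τ j) + ∑ j, ⟪E (τ j), U⟫ • J (A j η)

/-- Pairing with a family `a` that is dual to `u` and annihilates `v` and `Φ` reads off the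
coefficients of `u`. -/
lemma inner_sum_add_sum_add_of_dual {H ι : Type*} [NormedAddCommGroup H]
    [InnerProductSpace ℝ H] [Fintype ι] [DecidableEq ι] {a u v : ι → H} {Φ : H} {c : ℝ}
    (hu : ∀ j k, ⟪a j, u k⟫ = if j = k then c else 0) (hv : ∀ j k, ⟪a j, v k⟫ = 0)
    (hΦ : ∀ j, ⟪a j, Φ⟫ = 0) (P Q : ι → ℝ) (j : ι) :
    ⟪a j, (∑ k, P k • u k) + (∑ k, Q k • v k) + Φ⟫ = P j * c := by
  simp [inner_add_right, inner_sum, real_inner_smul_right, hu, hv, hΦ]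

lemma PiProj_add_eq {H : Type*} [NormedAddCommGroup H] [InnerProductSpace ℝ H]
    {n : ℕ} (E J : H →L[ℝ] H) (A : Fin n → H →L[ℝ] H) (η : H) (τ : Fin n → H) (U : H) :
    U = (∑ j, ⟪A j η, U⟫ • τ j) + (∑ j, (-⟪E (τ j), U⟫) • J (A j η))
      + PiProj E J A η τ U := by
  simp only [PiProj, neg_smul, Finset.sum_neg_distrib]
  abel

lemma continuous_PiProj {H : Type*} [NormedAddCommGroup H] [InnerProductSpace ℝ H]
    {n : ℕ} (E J : H →L[ℝ] H) (A : Fin n → H →L[ℝ] H) (η : H) (τ : Fin n → H) :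
    Continuous (PiProj E J A η τ) := by
  unfold PiProj
  fun_prop

lemma isLinearMap_PiProj {H : Type*} [NormedAddCommGroup H] [InnerProductSpace ℝ H]
    {n : ℕ} (E J : H →L[ℝ] H) (A : Fin n → H →L[ℝ] H) (η : H) (τ : Fin n → H) :
    IsLinearMap ℝ (PiProj E J A η τ) where
  map_add x y := by
    simp only [PiProj, inner_add_right, add_smul, Finset.sum_add_distrib]
    abel
  map_smul c x := by
    simp only [PiProj, real_inner_smul_right, mul_smul, ← Finset.smul_sum, smul_add, smul_sub]

lemma PiProj_eq_self {H : Type*} [NormedAddCommGroup H] [InnerProductSpace ℝ H]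
    {n : ℕ} (E J : H →L[ℝ] H) (A : Fin n → H →L[ℝ] H) (η : H) (τ : Fin n → H) {Φ : H}
    (hA : ∀ j, ⟪A j η, Φ⟫ = 0) (hE : ∀ j, ⟪E (τ j), Φ⟫ = 0) :
    PiProj E J A η τ Φ = Φ := by
  simp [PiProj, hA, hE]

/-- every `U` decomposes uniquely as
`U = Σ Pⱼ τⱼ + Σ Qʲ (J Aⱼ η) + Φ` with `Φ` symplectically orthogonal to the
soliton manifold (`⟨Aⱼη, Φ⟩ = 0 = ⟨Eτⱼ, Φ⟩`); the coefficients are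
`Qʲ = −⟨Eτⱼ, U⟩`, `Pⱼ = ⟨Aⱼη, U⟩` and `Φ = Π U`, and `Π` is a continuous
linear projection. -/
theorem phase_space_decomposition
    {H : Type*} [NormedAddCommGroup H] [InnerProductSpace ℝ H] {n : ℕ}
    (E J : H →L[ℝ] H) (A : Fin n → H →L[ℝ] H) (η : H) (τ : Fin n → H)
    (hE_skew : ∀ u w : H, ⟪E u, w⟫ = -⟪u, E w⟫)
    (hJE : ∀ u : H, J (E u) = u) (hEJ : ∀ u : H, E (J u) = u)
    (hA : ∀ (j : Fin n) (u w : H), ⟪A j u, w⟫ = ⟪u, A j w⟫)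
    (hnorm : ∀ j k : Fin n, ⟪A j (τ k), η⟫ = if j = k then (1 : ℝ) else 0)
    (hiso : ∀ j k : Fin n, ⟪E (τ j), τ k⟫ = 0)
    (horth : ∀ j k : Fin n, ⟪A j η, J (A k η)⟫ = 0)
    (U : H) :
    (∃! x : (Fin n → ℝ) × (Fin n → ℝ) × H,
      (∀ j, ⟪A j η, x.2.2⟫ = 0) ∧ (∀ j, ⟪E (τ j), x.2.2⟫ = 0) ∧
        U = (∑ j, x.1 j • τ j) + (∑ j, x.2.1 j • J (A j η)) + x.2.2)
    ∧ U = (∑ j, ⟪A j η, U⟫ • τ j) + (∑ j, (-⟪E (τ j), U⟫) • J (A j η))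
        + PiProj E J A η τ U
    ∧ (∀ j, ⟪A j η, PiProj E J A η τ U⟫ = 0)
    ∧ (∀ j, ⟪E (τ j), PiProj E J A η τ U⟫ = 0)
    ∧ Continuous (PiProj E J A η τ)
    ∧ IsLinearMap ℝ (PiProj E J A η τ)
    ∧ (∀ W : H, PiProj E J A η τ (PiProj E J A η τ W) = PiProj E J A η τ W) := by
  have hAτ : ∀ j k, ⟪A j η, τ k⟫ = if j = k then (1 : ℝ) else 0 := fun j k => by
    rw [hA, real_inner_comm, hnorm]
  have hEJA : ∀ j k, ⟪E (τ j), J (A k η)⟫ = if j = k then (-1 : ℝ) else 0 := fun j k => by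
    rw [hE_skew, hEJ, real_inner_comm, hAτ]
    simp only [eq_comm (a := k)]
    split_ifs <;> simp
  have hcoeff : ∀ (P Q : Fin n → ℝ) (Φ V : H), (∀ j, ⟪A j η, Φ⟫ = 0) →
      (∀ j, ⟪E (τ j), Φ⟫ = 0) →
      V = (∑ j, P j • τ j) + (∑ j, Q j • J (A j η)) + Φ →
      (∀ j, ⟪A j η, V⟫ = P j) ∧ ∀ j, ⟪E (τ j), V⟫ = -Q j := by
    rintro P Q Φ V h₁ h₂ rfl
    refine ⟨fun j => ?_, fun j => ?_⟩
    · rw [inner_sum_add_sum_add_of_dual hAτ horth h₁, mul_one]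
    · rw [add_comm (∑ k, P k • τ k), inner_sum_add_sum_add_of_dual hEJA hiso h₂, mul_neg_one]
  have h_projA : ∀ (V : H) (j : Fin n), ⟪A j η, PiProj E J A η τ V⟫ = 0 := fun V j => by
    simp [PiProj, inner_add_right, inner_sub_right, inner_sum, real_inner_smul_right, hAτ, horth]
  have h_projE : ∀ (V : H) (j : Fin n), ⟪E (τ j), PiProj E J A η τ V⟫ = 0 := fun V j => by
    simp [PiProj, inner_add_right, inner_sub_right, inner_sum, real_inner_smul_right, hEJA, hiso]
  have hU := PiProj_add_eq E J A η τ U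
  refine ⟨⟨(fun j => ⟪A j η, U⟫, fun j => -⟪E (τ j), U⟫, PiProj E J A η τ U),
    ⟨h_projA U, h_projE U, hU⟩, ?_⟩, hU, h_projA U, h_projE U, continuous_PiProj E J A η τ,
    isLinearMap_PiProj E J A η τ, fun W => PiProj_eq_self E J A η τ (h_projA W) (h_projE W)⟩
  rintro ⟨P, Q, Φ⟩ ⟨h₁, h₂, h₃⟩
  obtain ⟨hP, hQ⟩ := hcoeff P Q Φ U h₁ h₂ h₃
  obtain rfl : P = fun j => ⟪A j η, U⟫ := funext fun j => (hP j).symm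
  obtain rfl : Q = fun j => -⟪E (τ j), U⟫ := funext fun j => by rw [hQ, neg_neg]
  have hΦ : Φ = PiProj E J A η τ U := add_left_cancel (h₃.symm.trans hU)
  rw [hΦ]
end

section
/- Let H be a real Hilbert space, let 𝓗 : H → ℝ be Fréchet differentiable, let A₁, …, A_n : H → H be continuous self-adjoint linear operators, let I ⊆ ℝⁿ be open, let η : I → H be differentiable at p₀ ∈ I, and let λ ∈ ℝⁿ. Assume the weak bound state equation d𝓗(η(p₀)) v = Σ_{k=1}^{n} λ^k ⟨A_k η(p₀), v⟩ for all v ∈ H, and the normalization ⟨A_k η(p₀), (∂η/∂p_j)(p₀)⟩ = δ_{kj} for all k, j. Then the function f(p) := 𝓗(η(p)) satisfies (∂f/∂p_j)(p₀) = λ^j for each j ∈ {1, …, n}. -/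
open scoped RealInnerProductSpace

/-- if `η(p₀)` satisfies the weak bound state equation
`d𝓗(η(p₀)) v = Σₖ λᵏ ⟨Aₖ η(p₀), v⟩` and the normalization
`⟨Aₖ η(p₀), ∂η/∂pⱼ(p₀)⟩ = δₖⱼ`, then the energy along the bound state
manifold `f(p) = 𝓗(η(p))` satisfies `∂f/∂pⱼ(p₀) = λʲ`. -/
theorem energy_derivative_is_multiplier
    {H : Type*} [NormedAddCommGroup H] [InnerProductSpace ℝ H] {n : ℕ}
    (𝓗 : H → ℝ) (h𝓗 : Differentiable ℝ 𝓗)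
    (A : Fin n → H →L[ℝ] H) (hA : ∀ (k : Fin n) (u w : H), ⟪A k u, w⟫ = ⟪u, A k w⟫)
    (I : Set (Fin n → ℝ)) (hI : IsOpen I)
    (η : (Fin n → ℝ) → H) (p₀ : Fin n → ℝ) (hp₀ : p₀ ∈ I)
    (hη : DifferentiableAt ℝ η p₀)
    (lam : Fin n → ℝ)
    (hbound : ∀ v : H, fderiv ℝ 𝓗 (η p₀) v = ∑ k, lam k * ⟪A k (η p₀), v⟫)
    (hnorm : ∀ k j : Fin n,
      ⟪A k (η p₀), fderiv ℝ η p₀ (Pi.single j 1)⟫ = if k = j then (1 : ℝ) else 0) :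
    ∀ j : Fin n, fderiv ℝ (fun p => 𝓗 (η p)) p₀ (Pi.single j 1) = lam j := by
  intro j
  have hcomp := ((h𝓗 (η p₀)).hasFDerivAt.comp p₀ hη.hasFDerivAt).fderiv
  rw [Function.comp_def] at hcomp
  rw [hcomp, ContinuousLinearMap.comp_apply, hbound]
  simp [hnorm]
end

section
/- Let β : ℝ → ℝ be continuously differentiable with β(0) = 0, and define on Schwartz functions ψ : ℝ³ → ℂ the NLS Hamiltonian H(ψ) := ∫_{ℝ³} ( Σ_{j=1}^{3} |∂_j ψ(x)|² − β(|ψ(x)|²) ) dx. Then for all Schwartz functions ψ, χ : ℝ³ → ℂ the Gateaux derivative of H at ψ in the direction χ is d/dε H(ψ + ε χ)|_{ε=0} = 2 Re ∫_{ℝ³} ( −Δψ(x) − β'(|ψ(x)|²) ψ(x) ) · conj(χ(x)) dx. In particular, with the symplectic form ω(ψ₁, ψ₂) = 2 Re ∫_{ℝ³} i ψ₁ conj(ψ₂) dx, the Hamiltonian vector field of H at ψ is iΔψ + iβ'(|ψ|²)ψ, so the Hamilton equations of H are exactly the NLS ψ_t = iΔψ + iβ'(|ψ|²)ψ. -/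
open MeasureTheory SchwartzMap

/-- The NLS Hamiltonian `H(ψ) = ∫ (Σⱼ |∂ⱼψ|² − β(|ψ|²))`. -/
noncomputable def Hfun (β : ℝ → ℝ) (f : (Fin 3 → ℝ) → ℂ) : ℝ :=
  ∫ x, ((∑ j : Fin 3, ‖pdC j f x‖ ^ 2) - β (‖f x‖ ^ 2))

/-- The symplectic form `ω(ψ₁, ψ₂) = 2 Re ∫ i ψ₁ conj(ψ₂)`. -/
noncomputable def omegaForm (ψ₁ ψ₂ : (Fin 3 → ℝ) → ℂ) : ℝ :=
  2 * (∫ x, Complex.I * ψ₁ x * (starRingEnd ℂ) (ψ₂ x)).re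

open LineDeriv in
/-- The partial derivative of a Schwartz function is the Schwartz line derivative. -/
theorem pdC_coe (j : Fin 3) (f : 𝓢(Fin 3 → ℝ, ℂ)) :
    pdC j ⇑f = ⇑(∂_{(Pi.single j 1 : Fin 3 → ℝ)} f : 𝓢(Fin 3 → ℝ, ℂ)) := by
  ext x
  exact (SchwartzMap.lineDerivOp_apply_eq_fderiv _ _ _).symm

section DensityIntegral

variable {D : Type*} [NormedAddCommGroup D] [NormedSpace ℝ D] [MeasurableSpace D] [BorelSpace D]
  [SecondCountableTopology D] {μ : Measure D} [μ.HasTemperateGrowth]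
  {g : ℝ → ℝ}

/-- A `C¹` function vanishing at `0`, composed with `|w|²` for Schwartz `w`, is integrable. -/
theorem integrable_comp_norm_sq (hg : ContDiff ℝ 1 g) (hg0 : g 0 = 0) (w : 𝓢(D, ℂ)) :
    Integrable (fun x => g (‖w x‖ ^ 2)) μ := by
  set C := SchwartzMap.seminorm ℝ 0 0 w with hC
  have hwC : ∀ x, ‖w x‖ ≤ C := SchwartzMap.norm_le_seminorm ℝ w
  obtain ⟨M, hM⟩ := (isCompact_Icc (a := (0 : ℝ)) (b := C ^ 2)).exists_bound_of_continuousOn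
    (hg.continuous_deriv le_rfl).continuousOn
  have hM0 : 0 ≤ M := (norm_nonneg _).trans (hM 0 ⟨le_rfl, sq_nonneg C⟩)
  refine ((w.integrable (μ := μ)).norm.const_mul (M * C)).mono'
    (hg.continuous.comp (w.continuous.norm.pow 2)).aestronglyMeasurable (.of_forall fun x => ?_)
  have hmv := (convex_Icc (0 : ℝ) (C ^ 2)).norm_image_sub_le_of_norm_deriv_le
    (fun s _ => (hg.differentiable one_ne_zero).differentiableAt) hM
    (x := 0) (y := ‖w x‖ ^ 2) ⟨le_rfl, sq_nonneg C⟩ ⟨by positivity, by gcongr; exact hwC x⟩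
  rw [hg0, sub_zero, sub_zero, norm_pow, norm_norm] at hmv
  calc ‖g (‖w x‖ ^ 2)‖ ≤ M * ‖w x‖ ^ 2 := hmv
    _ = M * ‖w x‖ * ‖w x‖ := by ring
    _ ≤ M * C * ‖w x‖ := by gcongr; exact hwC x

/-- Differentiation under the integral sign for `∫ g(|u + εv|²)`. -/
theorem hasDerivAt_integral_comp_norm_sq (hg : ContDiff ℝ 1 g) (hg0 : g 0 = 0) (u v : 𝓢(D, ℂ)) :
    Integrable (fun x => deriv g (‖u x‖ ^ 2) * (2 * inner ℝ (u x) (v x))) μ ∧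
    HasDerivAt (fun ε : ℝ => ∫ x, g (‖u x + (ε : ℂ) * v x‖ ^ 2) ∂μ)
      (∫ x, deriv g (‖u x‖ ^ 2) * (2 * inner ℝ (u x) (v x)) ∂μ) 0 := by
  set C := SchwartzMap.seminorm ℝ 0 0 u + SchwartzMap.seminorm ℝ 0 0 v with hC
  obtain ⟨M, hM⟩ := (isCompact_Icc (a := (0 : ℝ)) (b := C ^ 2)).exists_bound_of_continuousOn
    (hg.continuous_deriv le_rfl).continuousOn
  have hM0 : 0 ≤ M := (norm_nonneg _).trans (hM 0 ⟨le_rfl, sq_nonneg C⟩)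
  have hw : ∀ x, ∀ ε ∈ Metric.ball (0 : ℝ) 1, ‖u x + (ε : ℂ) * v x‖ ≤ C := by
    intro x ε hε
    have hε1 : ‖(ε : ℂ)‖ ≤ 1 := by
      rw [Complex.norm_real]
      exact (mem_ball_zero_iff.1 hε).le
    calc ‖u x + (ε : ℂ) * v x‖ ≤ ‖u x‖ + ‖(ε : ℂ)‖ * ‖v x‖ :=
          (norm_add_le _ _).trans_eq (by rw [norm_mul])
      _ ≤ ‖u x‖ + 1 * ‖v x‖ := by gcongr
      _ ≤ C := by
          rw [one_mul]
          exact add_le_add (SchwartzMap.norm_le_seminorm ℝ u x) (SchwartzMap.norm_le_seminorm ℝ v x)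
  have key := hasDerivAt_integral_of_dominated_loc_of_deriv_le (μ := μ)
    (F := fun (ε : ℝ) x => g (‖u x + (ε : ℂ) * v x‖ ^ 2))
    (F' := fun (ε : ℝ) x => deriv g (‖u x + (ε : ℂ) * v x‖ ^ 2)
      * (2 * inner ℝ (u x + (ε : ℂ) * v x) (v x)))
    (x₀ := 0) (bound := fun x => M * (2 * C) * ‖v x‖)
    (Metric.ball_mem_nhds 0 one_pos) ?_ ?_ ?_ ?_ ?_ ?_
  · simpa using key
  · refine .of_forall fun ε => Continuous.aestronglyMeasurable ?_
    exact hg.continuous.comp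
      ((u.continuous.add (continuous_const.mul v.continuous)).norm.pow 2)
  · simpa using integrable_comp_norm_sq hg hg0 u
  · refine Continuous.aestronglyMeasurable ?_
    have hc := u.continuous.add ((continuous_const (y := ((0 : ℝ) : ℂ))).mul v.continuous)
    exact ((hg.continuous_deriv le_rfl).comp (hc.norm.pow 2)).mul
      (continuous_const.mul (hc.inner v.continuous))
  · refine .of_forall fun x ε hε => ?_
    have h := hw x ε hε
    rw [norm_mul, norm_mul, Real.norm_ofNat, mul_assoc M, mul_assoc 2]
    refine mul_le_mul (hM _ ⟨by positivity, by gcongr⟩) ?_ (by positivity) hM0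
    gcongr
    exact (norm_inner_le_norm _ _).trans (by gcongr)
  · exact v.integrable.norm.const_mul _
  · refine .of_forall fun x ε _ => ?_
    have hlin : HasDerivAt (fun ε : ℝ => u x + (ε : ℂ) * v x) (v x) ε := by
      simpa using (Complex.ofRealCLM.hasDerivAt.mul_const (v x)).const_add (u x)
    exact ((hg.differentiable one_ne_zero) _).hasDerivAt.comp ε hlin.norm_sq

end DensityIntegral

section PartialDerivatives

open LineDeriv

/-- The perturbation `u + εv` as a Schwartz function. -/
theorem coe_add_smul (u v : 𝓢(Fin 3 → ℝ, ℂ)) (ε : ℝ) :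
    ⇑(u + ε • v) = fun x => u x + (ε : ℂ) * v x := by
  ext x
  simp

/-- Partial derivatives commute with the perturbation `u + εv`. -/
theorem pdC_add_mul (j : Fin 3) (u v : 𝓢(Fin 3 → ℝ, ℂ)) (ε : ℝ) (x : Fin 3 → ℝ) :
    pdC j (fun x => u x + (ε : ℂ) * v x) x = pdC j u x + (ε : ℂ) * pdC j v x := by
  rw [← coe_add_smul, pdC_coe, pdC_coe, pdC_coe, lineDerivOp_add, lineDerivOp_smul, coe_add_smul]

/-- Integration by parts in the `j`-th direction. -/
theorem integral_inner_pdC (j : Fin 3) (u v : 𝓢(Fin 3 → ℝ, ℂ)) :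
    ∫ x, inner ℝ (pdC j u x) (pdC j v x) = -∫ x, inner ℝ (pdC j (pdC j u) x) (v x) := by
  simp only [pdC_coe]
  exact SchwartzMap.integral_bilinear_lineDerivOp_right_eq_neg_left (μ := volume)
    (∂_{(Pi.single j 1 : Fin 3 → ℝ)} u) v (innerSL ℝ) (Pi.single j 1)

theorem integrable_inner (u v : 𝓢(Fin 3 → ℝ, ℂ)) :
    Integrable (fun x => inner ℝ (u x) (v x)) :=
  (SchwartzMap.pairing (innerSL ℝ) u v).integrable (μ := volume)

/-- The Hamiltonian splits into its kinetic and potential parts on Schwartz functions. -/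
theorem Hfun_add_mul {β : ℝ → ℝ} (hβ : ContDiff ℝ 1 β) (hβ0 : β 0 = 0)
    (u v : 𝓢(Fin 3 → ℝ, ℂ)) (ε : ℝ) :
    Hfun β (fun x => u x + (ε : ℂ) * v x) =
      (∑ j : Fin 3, ∫ x, ‖pdC j u x + (ε : ℂ) * pdC j v x‖ ^ 2)
        - ∫ x, β (‖u x + (ε : ℂ) * v x‖ ^ 2) := by
  have hkin : ∀ j : Fin 3, Integrable fun x => ‖pdC j u x + (ε : ℂ) * pdC j v x‖ ^ 2 := by
    intro j
    have h := integrable_comp_norm_sq (μ := volume) (g := id) contDiff_id rfl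
      (∂_{(Pi.single j 1 : Fin 3 → ℝ)} u + ε • ∂_{(Pi.single j 1 : Fin 3 → ℝ)} v)
    simpa only [coe_add_smul, pdC_coe, id] using h
  have hpot : Integrable fun x => β (‖u x + (ε : ℂ) * v x‖ ^ 2) := by
    have h := integrable_comp_norm_sq (μ := volume) hβ hβ0 (u + ε • v)
    simpa only [coe_add_smul] using h
  simp only [Hfun, pdC_add_mul]
  rw [integral_sub (integrable_finsetSum _ fun j _ => hkin j) hpot,
    integral_finsetSum _ fun j _ => hkin j]

/-- The Laplacian of a Schwartz function is Schwartz. -/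
theorem lapC_coe (u : 𝓢(Fin 3 → ℝ, ℂ)) :
    lapC ⇑u = ⇑(∑ j : Fin 3, ∂_{(Pi.single j 1 : Fin 3 → ℝ)} (∂_{(Pi.single j 1 : Fin 3 → ℝ)} u) :
      𝓢(Fin 3 → ℝ, ℂ)) := by
  ext x
  simp [lapC, pdC_coe]

/-- The integrand of the Gateaux derivative is integrable. -/
theorem integrable_vectorField_mul_conj {β : ℝ → ℝ} (hβ : ContDiff ℝ 1 β)
    (u v : 𝓢(Fin 3 → ℝ, ℂ)) :
    Integrable fun x => (-(lapC (⇑u) x) - ((deriv β (‖u x‖ ^ 2) : ℝ) : ℂ) * u x)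
      * (starRingEnd ℂ) (v x) := by
  have hβ' := hβ.continuous_deriv le_rfl
  have hN : Continuous fun z : ℂ => ((deriv β (‖z‖ ^ 2) : ℝ) : ℂ) * z := by fun_prop
  obtain ⟨M, hM⟩ := (isCompact_closedBall (0 : ℂ)
    (SchwartzMap.seminorm ℝ 0 0 u)).exists_bound_of_continuousOn hN.continuousOn
  rw [lapC_coe]
  set L : 𝓢(Fin 3 → ℝ, ℂ) :=
    ∑ j : Fin 3, ∂_{(Pi.single j 1 : Fin 3 → ℝ)} (∂_{(Pi.single j 1 : Fin 3 → ℝ)} u)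
  have hv : Integrable fun x => (starRingEnd ℂ) (v x) :=
    Complex.conjLIE.toContinuousLinearEquiv.toContinuousLinearMap.integrable_comp v.integrable
  refine hv.bdd_mul (c := SchwartzMap.seminorm ℝ 0 0 L + M)
    (L.continuous.neg.sub (hN.comp u.continuous)).aestronglyMeasurable (.of_forall fun x => ?_)
  refine (norm_sub_le _ _).trans (add_le_add ?_ (hM _ ?_))
  · rw [norm_neg]
    exact SchwartzMap.norm_le_seminorm ℝ L x
  · exact mem_closedBall_zero_iff.2 (SchwartzMap.norm_le_seminorm ℝ u x)

end PartialDerivatives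

/-- the Gateaux derivative of the NLS Hamiltonian at `ψ` in the
direction `χ` is `2 Re ∫ (−Δψ − β'(|ψ|²)ψ) conj(χ)`; in particular this equals
`ω(iΔψ + iβ'(|ψ|²)ψ, χ)`, so the Hamiltonian vector field of `H` at `ψ` is
`iΔψ + iβ'(|ψ|²)ψ` and the Hamilton equations of `H` are the NLS. -/
theorem NLS_hamiltonian_vector_field
    (β : ℝ → ℝ) (hβ : ContDiff ℝ 1 β) (hβ0 : β 0 = 0)
    (ψ χ : SchwartzMap (Fin 3 → ℝ) ℂ) :
    HasDerivAt (fun ε : ℝ => Hfun β fun x => ψ x + (ε : ℂ) * χ x)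
      (2 * (∫ x, (-(lapC (⇑ψ) x) - ((deriv β (‖ψ x‖ ^ 2) : ℝ) : ℂ) * ψ x)
          * (starRingEnd ℂ) (χ x)).re) 0
    ∧ (2 * (∫ x, (-(lapC (⇑ψ) x) - ((deriv β (‖ψ x‖ ^ 2) : ℝ) : ℂ) * ψ x)
          * (starRingEnd ℂ) (χ x)).re)
        = omegaForm
            (fun x => Complex.I * lapC (⇑ψ) x
              + Complex.I * ((deriv β (‖ψ x‖ ^ 2) : ℝ) : ℂ) * ψ x) ⇑χ := by
  have hpot := hasDerivAt_integral_comp_norm_sq (μ := volume) hβ hβ0 ψ χ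
  have hkin : ∀ j : Fin 3, HasDerivAt
      (fun ε : ℝ => ∫ x, ‖pdC j ψ x + (ε : ℂ) * pdC j χ x‖ ^ 2)
      (-(2 * ∫ x, inner ℝ (pdC j (pdC j ψ) x) (χ x))) 0 := by
    intro j
    have h := (hasDerivAt_integral_comp_norm_sq (μ := volume) (g := id) contDiff_id rfl
      (LineDeriv.lineDerivOp (Pi.single j 1 : Fin 3 → ℝ) ψ)
      (LineDeriv.lineDerivOp (Pi.single j 1 : Fin 3 → ℝ) χ)).2
    simp only [← pdC_coe, deriv_id, one_mul, id, integral_const_mul, integral_inner_pdC] at h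
    rwa [mul_neg] at h
  have hlap : ∀ j : Fin 3, Integrable fun x => inner ℝ (pdC j (pdC j ψ) x) (χ x) := by
    intro j
    simp only [pdC_coe]
    exact integrable_inner _ χ
  have hre : ∀ x, ((-(lapC (⇑ψ) x) - ((deriv β (‖ψ x‖ ^ 2) : ℝ) : ℂ) * ψ x)
      * (starRingEnd ℂ) (χ x)).re = -(∑ j : Fin 3, inner ℝ (pdC j (pdC j ψ) x) (χ x))
        - deriv β (‖ψ x‖ ^ 2) * inner ℝ (ψ x) (χ x) := by
    intro x
    rw [← sum_inner, real_inner_comm, real_inner_comm (χ x) (ψ x), Complex.inner, Complex.inner]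
    simp only [lapC, Complex.mul_re, Complex.sub_re, Complex.sub_im, Complex.neg_re,
      Complex.neg_im, Complex.mul_im, Complex.conj_re, Complex.conj_im, Complex.ofReal_re,
      Complex.ofReal_im]
    ring
  have hint : Integrable fun x => (-(lapC (⇑ψ) x) - ((deriv β (‖ψ x‖ ^ 2) : ℝ) : ℂ) * ψ x)
      * (starRingEnd ℂ) (χ x) :=
    integrable_vectorField_mul_conj hβ ψ χ
  constructor
  · simp only [Hfun_add_mul hβ hβ0]
    refine ((HasDerivAt.fun_sum fun j (_ : j ∈ Finset.univ) => hkin j).fun_sub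
      hpot.2).congr_deriv ?_
    have hpot' : Integrable fun x => deriv β (‖ψ x‖ ^ 2) * inner ℝ (ψ x) (χ x) := by
      refine (hpot.1.const_mul (1 / 2)).congr (.of_forall fun x => ?_)
      ring
    symm
    rw [← RCLike.re_eq_complex_re, ← integral_re hint]
    simp only [RCLike.re_eq_complex_re, hre]
    rw [integral_sub (integrable_finsetSum _ fun j _ => hlap j).fun_neg hpot', integral_neg,
      integral_finsetSum _ fun j _ => hlap j, Finset.sum_neg_distrib, ← Finset.mul_sum]
    simp only [mul_left_comm _ (2 : ℝ), integral_const_mul]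
    ring
  · rw [omegaForm]
    congr 3 with x
    linear_combination (-(lapC (⇑ψ) x) - ((deriv β (‖ψ x‖ ^ 2) : ℝ) : ℂ) * ψ x)
      * (starRingEnd ℂ) (χ x) * Complex.I_sq
end
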